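/- arXiv:1411.3386 — 3 statements merged into one kernel-verified Lean document; each statement's English description precedes it below -/
import Mathlib

section
/- Fix φⱼ, θⱼ ∈ ℝ with sin θⱼ ≠ 0, and let s = (s₁, s₂)ᵀ ∈ ℝ². Define r = (r₁, r₂, r₃)ᵀ ∈ ℝ³ by rᵢ = sᵀ Hᵢ s, where Hᵢ is the 2×2 matrix with entries (Hᵢ)₁₁ = ∂²fᵢ/∂θ², (Hᵢ)₁₂ = (Hᵢ)₂₁ = (1/sin θ) ∂²fᵢ/∂θ∂φ, (Hᵢ)₂₂ = (1/sin² θ) ∂²fᵢ/∂φ², all evaluated at (φⱼ, θⱼ). Then sᵀ J(φⱼ,θⱼ)ᵀ r = s₁ s₂² (cos θⱼ / sin θⱼ). -/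
open Matrix Real

/-- The tangent-plane matrix `J(φ,θ)`. -/
noncomputable def J (φ θ : ℝ) : Matrix (Fin 3) (Fin 2) ℝ :=
  !![Real.cos φ * Real.cos θ, -Real.sin φ;
     Real.sin φ * Real.cos θ, Real.cos φ;
     -Real.sin θ, 0]

/-- The components `f₁, f₂, f₃` of the spherical-coordinate parametrization
`x(φ,θ) = (cos φ sin θ, sin φ sin θ, cos θ)ᵀ`, as functions of `(φ, θ)`. -/
noncomputable def fcomp (i : Fin 3) (φ θ : ℝ) : ℝ :=
  ![Real.cos φ * Real.sin θ, Real.sin φ * Real.sin θ, Real.cos θ] i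

/-- `∂²fᵢ/∂θ²` evaluated at `(φⱼ, θⱼ)`. -/
noncomputable def d2θθ (i : Fin 3) (φj θj : ℝ) : ℝ :=
  deriv (fun θ => deriv (fun θ' => fcomp i φj θ') θ) θj

/-- `∂²fᵢ/∂θ∂φ` evaluated at `(φⱼ, θⱼ)`. -/
noncomputable def d2θφ (i : Fin 3) (φj θj : ℝ) : ℝ :=
  deriv (fun θ => deriv (fun φ => fcomp i φ θ) φj) θj

/-- `∂²fᵢ/∂φ²` evaluated at `(φⱼ, θⱼ)`. -/
noncomputable def d2φφ (i : Fin 3) (φj θj : ℝ) : ℝ :=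
  deriv (fun φ => deriv (fun φ' => fcomp i φ' θj) φ) φj

/-- The Hessian-type matrix `Hᵢ` of second partial derivatives of `fᵢ`,
with entries `(Hᵢ)₁₁ = fᵢθθ`, `(Hᵢ)₁₂ = (Hᵢ)₂₁ = fᵢθφ / sin θ`,
`(Hᵢ)₂₂ = fᵢφφ / sin² θ`, evaluated at `(φⱼ, θⱼ)`. -/
noncomputable def Hmat (i : Fin 3) (φj θj : ℝ) : Matrix (Fin 2) (Fin 2) ℝ :=
  !![d2θθ i φj θj, d2θφ i φj θj / Real.sin θj;
     d2θφ i φj θj / Real.sin θj, d2φφ i φj θj / (Real.sin θj)^2]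

theorem d2θθ_eq (i : Fin 3) (φ θ : ℝ) : d2θθ i φ θ = -fcomp i φ θ := by
  fin_cases i <;> simp [d2θθ, fcomp]

theorem d2θφ_eq (i : Fin 3) (φ θ : ℝ) :
    d2θφ i φ θ = ![-Real.sin φ * Real.cos θ, Real.cos φ * Real.cos θ, 0] i := by
  fin_cases i <;> simp [d2θφ, fcomp]

theorem d2φφ_eq (i : Fin 3) (φ θ : ℝ) :
    d2φφ i φ θ = ![-(Real.cos φ * Real.sin θ), -(Real.sin φ * Real.sin θ), 0] i := by
  fin_cases i <;> simp [d2φφ, fcomp]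

/-- Fix `φⱼ, θⱼ` with `sin θⱼ ≠ 0`, let `s ∈ ℝ²`, and let `r ∈ ℝ³` have components
`rᵢ = sᵀ Hᵢ s`.  Then `sᵀ J(φⱼ,θⱼ)ᵀ r = s₁ s₂² (cos θⱼ / sin θⱼ)`. -/
theorem key_tangent_plane_identity (φj θj : ℝ) (hθ : Real.sin θj ≠ 0)
    (s : Fin 2 → ℝ) (r : Fin 3 → ℝ)
    (hr : ∀ i, r i = s ⬝ᵥ (Hmat i φj θj).mulVec s) :
    s ⬝ᵥ (J φj θj)ᵀ.mulVec r = s 0 * (s 1)^2 * (Real.cos θj / Real.sin θj) := by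
  simp [Matrix.mulVec, dotProduct, Fin.sum_univ_succ, _root_.J, hr, Hmat,
    d2θθ_eq, d2θφ_eq, d2φφ_eq, fcomp]
  field_simp
  have hφ := Real.sin_sq_add_cos_sq φj
  grind
end

section
/- Let F, H : ℝ² → ℝ be continuously differentiable, and let U₀, V₀ : ℝ² → ℝ be three-times continuously differentiable functions satisfying ΔU₀ + F(U₀, V₀) = 0 and ΔV₀ + H(U₀, V₀) = 0 on all of ℝ², where Δ = ∂²/∂s₁² + ∂²/∂s₂². For real constants A and B, define W(s₁,s₂) = A s₂² ∂₁U₀ + B s₁ s₂ ∂₂U₀ and Z(s₁,s₂) = A s₂² ∂₁V₀ + B s₁ s₂ ∂₂V₀. Then at every point of ℝ²: ΔW + F_U(U₀,V₀) W + F_V(U₀,V₀) Z = 2 s₂ (2A + B) ∂₁∂₂U₀ + 2B s₁ ∂₂∂₂U₀ + 2A ∂₁U₀, and ΔZ + H_U(U₀,V₀) W + H_V(U₀,V₀) Z = 2 s₂ (2A + B) ∂₁∂₂V₀ + 2B s₁ ∂₂∂₂V₀ + 2A ∂₁V₀, where F_U, F_V (resp. H_U, H_V) denote the partial derivatives of F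 (resp. H) with respect to its first and second arguments. -/
open Real

/-- Partial derivative with respect to the first coordinate of a function `ℝ² → ℝ`
(written in curried form). -/
noncomputable def pd1 (g : ℝ → ℝ → ℝ) : ℝ → ℝ → ℝ := fun a b => deriv (fun x => g x b) a

/-- Partial derivative with respect to the second coordinate of a function `ℝ² → ℝ`
(written in curried form). -/
noncomputable def pd2 (g : ℝ → ℝ → ℝ) : ℝ → ℝ → ℝ := fun a b => deriv (fun y => g a y) b

/-- The planar Laplacian `Δ = ∂₁∂₁ + ∂₂∂₂`. -/
noncomputable def lap (g : ℝ → ℝ → ℝ) : ℝ → ℝ → ℝ :=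
  fun a b => pd1 (pd1 g) a b + pd2 (pd2 g) a b

/-- The first partial derivative is the total derivative applied to `(1, 0)`. -/
theorem uncurry_pd1_eq {g : ℝ → ℝ → ℝ} (hg : Differentiable ℝ (Function.uncurry g)) :
    Function.uncurry (pd1 g) = fun p => fderiv ℝ (Function.uncurry g) p (1, 0) := by
  ext ⟨a, b⟩
  exact ((hg (a, b)).hasFDerivAt.comp_hasDerivAt a
    ((hasDerivAt_id a).prodMk (hasDerivAt_const a b))).deriv

/-- The second partial derivative is the total derivative applied to `(0, 1)`. -/
theorem uncurry_pd2_eq {g : ℝ → ℝ → ℝ} (hg : Differentiable ℝ (Function.uncurry g)) :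
    Function.uncurry (pd2 g) = fun p => fderiv ℝ (Function.uncurry g) p (0, 1) := by
  ext ⟨a, b⟩
  exact ((hg (a, b)).hasFDerivAt.comp_hasDerivAt b
    ((hasDerivAt_const b a).prodMk (hasDerivAt_id b))).deriv

theorem hasDerivAt_pd1 {g : ℝ → ℝ → ℝ} (hg : Differentiable ℝ (Function.uncurry g)) (a b : ℝ) :
    HasDerivAt (fun x => g x b) (pd1 g a b) a := by
  have h : DifferentiableAt ℝ (fun x => Function.uncurry g (x, b)) a := by fun_prop
  exact h.hasDerivAt

theorem hasDerivAt_pd2 {g : ℝ → ℝ → ℝ} (hg : Differentiable ℝ (Function.uncurry g)) (a b : ℝ) :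
    HasDerivAt (fun y => g a y) (pd2 g a b) b := by
  have h : DifferentiableAt ℝ (fun y => Function.uncurry g (a, y)) b := by fun_prop
  exact h.hasDerivAt

theorem contDiff_pd1 {n : ℕ} {g : ℝ → ℝ → ℝ} (hg : ContDiff ℝ (n + 1) (Function.uncurry g)) :
    ContDiff ℝ n (Function.uncurry (pd1 g)) := by
  rw [uncurry_pd1_eq (hg.differentiable (by simp))]
  exact (hg.fderiv_right le_rfl).clm_apply contDiff_const

theorem contDiff_pd2 {n : ℕ} {g : ℝ → ℝ → ℝ} (hg : ContDiff ℝ (n + 1) (Function.uncurry g)) :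
    ContDiff ℝ n (Function.uncurry (pd2 g)) := by
  rw [uncurry_pd2_eq (hg.differentiable (by simp))]
  exact (hg.fderiv_right le_rfl).clm_apply contDiff_const

/-- Mixed second partial derivatives of a `C²` function commute. -/
theorem pd2_pd1_eq_pd1_pd2 {g : ℝ → ℝ → ℝ} (hg : ContDiff ℝ 2 (Function.uncurry g)) :
    pd2 (pd1 g) = pd1 (pd2 g) := by
  have hd : Differentiable ℝ (Function.uncurry g) := hg.differentiable (by simp)
  have h1 := contDiff_pd1 (n := 1) (by simpa [one_add_one_eq_two] using hg)
  have h2 := contDiff_pd2 (n := 1) (by simpa [one_add_one_eq_two] using hg)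
  have hdd : Differentiable ℝ (fderiv ℝ (Function.uncurry g)) :=
    (hg.fderiv_right (m := 1) (by simp [one_add_one_eq_two])).differentiable (by simp)
  ext a b
  have e1 := congrFun (uncurry_pd2_eq (h1.differentiable (by simp))) (a, b)
  have e2 := congrFun (uncurry_pd1_eq (h2.differentiable (by simp))) (a, b)
  rw [uncurry_pd1_eq hd, fderiv_clm_apply (hdd _) (by fun_prop)] at e1
  rw [uncurry_pd2_eq hd, fderiv_clm_apply (hdd _) (by fun_prop)] at e2
  have hs : IsSymmSndFDerivAt ℝ (Function.uncurry g) (a, b) :=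
    hg.contDiffAt.isSymmSndFDerivAt (by simp)
  simp only [Function.uncurry_apply_pair] at e1 e2
  rw [e1, e2]
  simpa using hs.eq (0, 1) (1, 0)

/-- The derivative of `t ↦ F (u t) (v t)` in terms of the partial derivatives of `F`. -/
theorem hasDerivAt_comp_pd {F : ℝ → ℝ → ℝ} (hF : Differentiable ℝ (Function.uncurry F))
    {u v : ℝ → ℝ} {u' v' t : ℝ} (hu : HasDerivAt u u' t) (hv : HasDerivAt v v' t) :
    HasDerivAt (fun x => F (u x) (v x)) (pd1 F (u t) (v t) * u' + pd2 F (u t) (v t) * v') t := by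
  have e1 := congrFun (uncurry_pd1_eq hF) (u t, v t)
  have e2 := congrFun (uncurry_pd2_eq hF) (u t, v t)
  simp only [Function.uncurry_apply_pair] at e1 e2
  refine ((hF (u t, v t)).hasFDerivAt.comp_hasDerivAt t (hu.prodMk hv)).congr_deriv ?_
  have : ((u', v') : ℝ × ℝ) = u' • (1, 0) + v' • (0, 1) := by simp
  rw [this, map_add, map_smul, map_smul, e1, e2, smul_eq_mul, smul_eq_mul]
  ring

/-- The Laplacian of `A s₂² ∂₁g + B s₁ s₂ ∂₂g` in terms of the partial derivatives
`k₁`, `k₂` of `Δg`. -/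
theorem lap_quadratic_combination {g : ℝ → ℝ → ℝ} (hg : ContDiff ℝ 3 (Function.uncurry g))
    (A B a b k₁ k₂ : ℝ)
    (hk₁ : HasDerivAt (fun x => lap g x b) k₁ a) (hk₂ : HasDerivAt (fun y => lap g a y) k₂ b) :
    lap (fun s₁ s₂ => A * s₂ ^ 2 * pd1 g s₁ s₂ + B * s₁ * s₂ * pd2 g s₁ s₂) a b
      = A * b ^ 2 * k₁ + B * a * b * k₂ + 2 * b * (2 * A + B) * pd1 (pd2 g) a b
        + 2 * B * a * pd2 (pd2 g) a b + 2 * A * pd1 g a b := by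
  have c1 := contDiff_pd1 (n := 2) (g := g) (by convert hg using 1; norm_num)
  have c2 := contDiff_pd2 (n := 2) (g := g) (by convert hg using 1; norm_num)
  have c11 := contDiff_pd1 (n := 1) (by simpa [one_add_one_eq_two] using c1)
  have c12 := contDiff_pd1 (n := 1) (by simpa [one_add_one_eq_two] using c2)
  have c22 := contDiff_pd2 (n := 1) (by simpa [one_add_one_eq_two] using c2)
  have hc : pd2 (pd1 g) = pd1 (pd2 g) := pd2_pd1_eq_pd1_pd2 (hg.of_le (by norm_num))
  have hc2 : pd2 (pd1 (pd2 g)) = pd1 (pd2 (pd2 g)) := pd2_pd1_eq_pd1_pd2 c2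
  have hc1 : pd1 (pd1 (pd2 g)) = pd2 (pd1 (pd1 g)) := by
    rw [← hc, pd2_pd1_eq_pd1_pd2 c1]
  have d1 := c1.differentiable (by simp)
  have d2 := c2.differentiable (by simp)
  have d11 := c11.differentiable (by simp)
  have d12 := c12.differentiable (by simp)
  have d22 := c22.differentiable (by simp)
  have e1 : k₁ = pd1 (pd1 (pd1 g)) a b + pd1 (pd2 (pd2 g)) a b :=
    hk₁.unique ((hasDerivAt_pd1 d11 a b).add (hasDerivAt_pd1 d22 a b))
  have e2 : k₂ = pd2 (pd1 (pd1 g)) a b + pd2 (pd2 (pd2 g)) a b :=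
    hk₂.unique ((hasDerivAt_pd2 d11 a b).add (hasDerivAt_pd2 d22 a b))
  set w : ℝ → ℝ → ℝ :=
    fun s₁ s₂ => A * s₂ ^ 2 * pd1 g s₁ s₂ + B * s₁ * s₂ * pd2 g s₁ s₂
  have w1 : pd1 w = fun s₁ s₂ => A * s₂ ^ 2 * pd1 (pd1 g) s₁ s₂
      + (B * s₂ * pd2 g s₁ s₂ + B * s₁ * s₂ * pd1 (pd2 g) s₁ s₂) := by
    ext x y
    refine HasDerivAt.deriv ((((hasDerivAt_pd1 d1 x y).const_mul (A * y ^ 2)).add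
      ((((hasDerivAt_id x).const_mul B).mul_const y).mul (hasDerivAt_pd1 d2 x y))).congr_deriv ?_)
    simp
  have w2 : pd2 w = fun s₁ s₂ => (2 * A * s₂ * pd1 g s₁ s₂ + A * s₂ ^ 2 * pd1 (pd2 g) s₁ s₂)
      + (B * s₁ * pd2 g s₁ s₂ + B * s₁ * s₂ * pd2 (pd2 g) s₁ s₂) := by
    ext x y
    have h := hasDerivAt_pd2 d1 x y
    rw [hc] at h
    refine HasDerivAt.deriv ((((((hasDerivAt_id y).pow 2).const_mul A).mul h).add
      (((hasDerivAt_id y).const_mul (B * x)).mul (hasDerivAt_pd2 d2 x y))).congr_deriv ?_)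
    simp only [id, Pi.pow_apply, Nat.cast_ofNat]
    ring
  have w11 : pd1 (pd1 w) a b = A * b ^ 2 * pd1 (pd1 (pd1 g)) a b
      + 2 * B * b * pd1 (pd2 g) a b + B * a * b * pd1 (pd1 (pd2 g)) a b := by
    rw [w1]
    refine HasDerivAt.deriv ((((hasDerivAt_pd1 d11 a b).const_mul (A * b ^ 2)).add
      (((hasDerivAt_pd1 d2 a b).const_mul (B * b)).add
      ((((hasDerivAt_id a).const_mul B).mul_const b).mul (hasDerivAt_pd1 d12 a b)))).congr_deriv ?_)
    simp
    ring
  have w22 : pd2 (pd2 w) a b = 2 * A * pd1 g a b + 4 * A * b * pd1 (pd2 g) a b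
      + A * b ^ 2 * pd2 (pd1 (pd2 g)) a b
      + 2 * B * a * pd2 (pd2 g) a b + B * a * b * pd2 (pd2 (pd2 g)) a b := by
    rw [w2]
    have h := hasDerivAt_pd2 d1 a b
    rw [hc] at h
    refine HasDerivAt.deriv ((((((hasDerivAt_id b).const_mul (2 * A)).mul h).add
      ((((hasDerivAt_id b).pow 2).const_mul A).mul (hasDerivAt_pd2 d12 a b))).add
      (((hasDerivAt_pd2 d2 a b).const_mul (B * a)).add
      (((hasDerivAt_id b).const_mul (B * a)).mul (hasDerivAt_pd2 d22 a b)))).congr_deriv ?_)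
    simp
    ring
  rw [lap, w11, w22, e1, e2, hc1, hc2]
  ring

/-- If `Δg = -G(U, V)`, then `A s₂² ∂₁g + B s₁ s₂ ∂₂g` solves the linearized equation with an
explicit right-hand side. -/
theorem linearized_quadratic_combination {G U V g : ℝ → ℝ → ℝ}
    (hG : Differentiable ℝ (Function.uncurry G)) (hU : Differentiable ℝ (Function.uncurry U))
    (hV : Differentiable ℝ (Function.uncurry V)) (hg : ContDiff ℝ 3 (Function.uncurry g))
    (hpde : ∀ a b : ℝ, lap g a b + G (U a b) (V a b) = 0) (A B a b : ℝ) :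
    lap (fun s₁ s₂ => A * s₂ ^ 2 * pd1 g s₁ s₂ + B * s₁ * s₂ * pd2 g s₁ s₂) a b
        + pd1 G (U a b) (V a b) * (A * b ^ 2 * pd1 U a b + B * a * b * pd2 U a b)
        + pd2 G (U a b) (V a b) * (A * b ^ 2 * pd1 V a b + B * a * b * pd2 V a b)
      = 2 * b * (2 * A + B) * pd1 (pd2 g) a b
        + 2 * B * a * pd2 (pd2 g) a b + 2 * A * pd1 g a b := by
  have hlap : lap g = fun x y => -G (U x y) (V x y) := by
    ext x y
    exact eq_neg_of_add_eq_zero_left (hpde x y)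
  have h1 := (hasDerivAt_comp_pd hG (hasDerivAt_pd1 hU a b) (hasDerivAt_pd1 hV a b)).neg
  have h2 := (hasDerivAt_comp_pd hG (hasDerivAt_pd2 hU a b) (hasDerivAt_pd2 hV a b)).neg
  rw [lap_quadratic_combination hg A B a b _ _ (by rw [hlap]; exact h1) (by rw [hlap]; exact h2)]
  ring

/-- Core verification identity for the static component of the first-order inner
solution: if `ΔU₀ + F(U₀,V₀) = 0` and `ΔV₀ + H(U₀,V₀) = 0` on `ℝ²`, and
`W = A s₂² ∂₁U₀ + B s₁ s₂ ∂₂U₀`, `Z = A s₂² ∂₁V₀ + B s₁ s₂ ∂₂V₀`, then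
`ΔW + F_U W + F_V Z = 2 s₂ (2A + B) ∂₁∂₂U₀ + 2B s₁ ∂₂∂₂U₀ + 2A ∂₁U₀`, and
similarly for `Z` with `H` and `V₀`. -/
theorem static_component_core_identity
    (F H U₀ V₀ : ℝ → ℝ → ℝ)
    (hF : ContDiff ℝ 1 (Function.uncurry F)) (hH : ContDiff ℝ 1 (Function.uncurry H))
    (hU : ContDiff ℝ 3 (Function.uncurry U₀)) (hV : ContDiff ℝ 3 (Function.uncurry V₀))
    (hpdeU : ∀ a b : ℝ, lap U₀ a b + F (U₀ a b) (V₀ a b) = 0)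
    (hpdeV : ∀ a b : ℝ, lap V₀ a b + H (U₀ a b) (V₀ a b) = 0)
    (A B : ℝ) (W Z : ℝ → ℝ → ℝ)
    (hW : W = fun s₁ s₂ => A * s₂ ^ 2 * pd1 U₀ s₁ s₂ + B * s₁ * s₂ * pd2 U₀ s₁ s₂)
    (hZ : Z = fun s₁ s₂ => A * s₂ ^ 2 * pd1 V₀ s₁ s₂ + B * s₁ * s₂ * pd2 V₀ s₁ s₂) :
    ∀ s₁ s₂ : ℝ,
      (lap W s₁ s₂ + pd1 F (U₀ s₁ s₂) (V₀ s₁ s₂) * W s₁ s₂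
          + pd2 F (U₀ s₁ s₂) (V₀ s₁ s₂) * Z s₁ s₂
        = 2 * s₂ * (2 * A + B) * pd1 (pd2 U₀) s₁ s₂
          + 2 * B * s₁ * pd2 (pd2 U₀) s₁ s₂ + 2 * A * pd1 U₀ s₁ s₂)
      ∧ (lap Z s₁ s₂ + pd1 H (U₀ s₁ s₂) (V₀ s₁ s₂) * W s₁ s₂
          + pd2 H (U₀ s₁ s₂) (V₀ s₁ s₂) * Z s₁ s₂
        = 2 * s₂ * (2 * A + B) * pd1 (pd2 V₀) s₁ s₂
          + 2 * B * s₁ * pd2 (pd2 V₀) s₁ s₂ + 2 * A * pd1 V₀ s₁ s₂) := by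
  have dU : Differentiable ℝ (Function.uncurry U₀) := hU.differentiable (by simp)
  have dV : Differentiable ℝ (Function.uncurry V₀) := hV.differentiable (by simp)
  subst hW hZ
  intro s₁ s₂
  exact ⟨linearized_quadratic_combination (hF.differentiable (by simp)) dU dV hU hpdeU A B s₁ s₂,
    linearized_quadratic_combination (hH.differentiable (by simp)) dU dV hV hpdeV A B s₁ s₂⟩
end

section
/- Let E > 0 and A ≠ 0 be real constants, and let x₁, x₂ : ℝ → ℝ³ be differentiable with |x₁(σ)| = |x₂(σ)| = 1 and x₁(σ) ≠ x₂(σ) for all σ, satisfying the two-spot system x₁′ = (2E/A)(I − x₁x₁ᵀ) x₂/|x₂ − x₁|² and x₂′ = (2E/A)(I − x₂x₂ᵀ) x₁/|x₁ − x₂|². Then for all σ, d/dσ ⟨x₁(σ), x₂(σ)⟩ = (2E/A)(1 + ⟨x₁(σ), x₂(σ)⟩). -/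
open Matrix

theorem HasDerivAt.dotProduct {ι : Type*} [Fintype ι] {f g : ℝ → ι → ℝ} {f' g' : ι → ℝ} {t : ℝ}
    (hf : HasDerivAt f f' t) (hg : HasDerivAt g g' t) :
    HasDerivAt (fun s => f s ⬝ᵥ g s) (f' ⬝ᵥ g t + f t ⬝ᵥ g') t := by
  simp only [_root_.dotProduct, ← Finset.sum_add_distrib]
  exact HasDerivAt.fun_sum fun i _ => (hasDerivAt_pi.mp hf i).mul (hasDerivAt_pi.mp hg i)

theorem projection_mulVec_dotProduct_self {ι : Type*} [Fintype ι] [DecidableEq ι] (u v : ι → ℝ) :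
    ((1 : Matrix ι ι ℝ) - vecMulVec u u).mulVec v ⬝ᵥ v = v ⬝ᵥ v - (u ⬝ᵥ v) ^ 2 := by
  simp [sub_mulVec, vecMulVec_mulVec, sub_dotProduct, pow_two]

theorem sub_dotProduct_sub_of_unit {ι : Type*} [Fintype ι] {u v : ι → ℝ}
    (hu : u ⬝ᵥ u = 1) (hv : v ⬝ᵥ v = 1) :
    (u - v) ⬝ᵥ (u - v) = 2 * (1 - u ⬝ᵥ v) := by
  rw [sub_dotProduct, dotProduct_sub, dotProduct_sub, hu, hv, dotProduct_comm v u]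
  ring

/-- For the two-spot slow dynamics with common strength `E` and mobility `A`,
the inner product `⟨x₁, x₂⟩ = cos γ₁,₂` satisfies
`d/dσ ⟨x₁, x₂⟩ = (2E/A)(1 + ⟨x₁, x₂⟩)`.  (Here `⟨x, y⟩ = x ⬝ᵥ y` and
`|y − x|² = (y − x) ⬝ᵥ (y − x)` are the Euclidean quantities on `ℝ³`.) -/
theorem two_spot_angle_ode
    (E A : ℝ) (hE : 0 < E) (hA : A ≠ 0)
    (x₁ x₂ : ℝ → Fin 3 → ℝ)
    (h1 : ∀ σ, x₁ σ ⬝ᵥ x₁ σ = 1) (h2 : ∀ σ, x₂ σ ⬝ᵥ x₂ σ = 1)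
    (hsep : ∀ σ, x₁ σ ≠ x₂ σ)
    (hx1 : ∀ σ, HasDerivAt x₁
      ((2 * E / (A * ((x₂ σ - x₁ σ) ⬝ᵥ (x₂ σ - x₁ σ)))) •
        ((1 : Matrix (Fin 3) (Fin 3) ℝ) - Matrix.vecMulVec (x₁ σ) (x₁ σ)).mulVec (x₂ σ)) σ)
    (hx2 : ∀ σ, HasDerivAt x₂
      ((2 * E / (A * ((x₁ σ - x₂ σ) ⬝ᵥ (x₁ σ - x₂ σ)))) •
        ((1 : Matrix (Fin 3) (Fin 3) ℝ) - Matrix.vecMulVec (x₂ σ) (x₂ σ)).mulVec (x₁ σ)) σ) :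
    ∀ σ, HasDerivAt (fun t => x₁ t ⬝ᵥ x₂ t)
      (2 * E / A * (1 + x₁ σ ⬝ᵥ x₂ σ)) σ := by
  intro σ
  have hd := sub_dotProduct_sub_of_unit (h1 σ) (h2 σ)
  have hd' := sub_dotProduct_sub_of_unit (h2 σ) (h1 σ)
  rw [dotProduct_comm (x₂ σ)] at hd'
  have hc : 1 - x₁ σ ⬝ᵥ x₂ σ ≠ 0 := by
    intro h
    rw [h, mul_zero, dotProduct_self_eq_zero, sub_eq_zero] at hd
    exact hsep σ hd
  convert (hx1 σ).dotProduct (hx2 σ) using 1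
  rw [dotProduct_comm (x₁ σ) (_ • _), smul_dotProduct, smul_dotProduct,
    projection_mulVec_dotProduct_self, projection_mulVec_dotProduct_self, h1, h2, hd, hd',
    dotProduct_comm (x₂ σ)]
  simp only [smul_eq_mul]
  field_simp
  ring
end
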